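/- If u is a solution of the imperfect-bonding conductivity problem with boundary data φ and constants U1, U2, and û is a solution of the imperfect-bonding conductivity problem with the same boundary data φ and constants Û1, Û2, then u = û on closure Ω̃, and consequently U_j = Û_j for j = 1, 2. -/

import Mathlib

open MeasureTheory Metric Set
open scoped RealInnerProductSpace ENNReal

noncomputable section

abbrev E (k : ℕ) := EuclideanSpace ℝ (Fin k)

/-- Laplacian: sum of pure second directional derivatives. -/
def elap {k : ℕ} (u : E k → ℝ) (x : E k) : ℝ :=
  ∑ i : Fin k, iteratedFDeriv ℝ 2 u x ![EuclideanSpace.single i 1, EuclideanSpace.single i 1]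

/-- `u` is a solution of the imperfect-bonding conductivity problem on
`Ω̃ := Ω ∖ (closure D1 ∪ closure D2)`, where `D_j` is the open ball with
center `p j` and radius `r j`, with boundary data `φ` and constants `U j`. -/
def IsCondSol {n : ℕ} (γ : ℝ) (Om : Set (E n)) (p : Fin 2 → E n) (r : Fin 2 → ℝ)
    (φ : E n → ℝ) (U : Fin 2 → ℝ) (u : E n → ℝ) : Prop :=
  -- Ω̃ and the interface spheres
  (fun Omt S =>
    ContinuousOn u (closure Omt) ∧
    ContDiffOn ℝ 2 u Omt ∧
    (∀ x ∈ Omt, elap u x = 0) ∧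
    (∀ x ∈ Omt ∪ S 0 ∪ S 1, DifferentiableAt ℝ u x) ∧
    ContinuousOn (fun x => gradient u x) (Omt ∪ S 0 ∪ S 1) ∧
    -- Robin conditions `u + γ ∂_ν u = U_j` on `∂D_j`, `ν(x) = (p j - x)/r j`
    (∀ j : Fin 2, ∀ x ∈ S j, u x + γ * ⟪(r j)⁻¹ • (p j - x), gradient u x⟫ = U j) ∧
    -- zero-flux conditions
    (∀ j : Fin 2, ∫ x in S j, ⟪(r j)⁻¹ • (p j - x), gradient u x⟫ ∂(μH[(n:ℝ) - 1]) = 0) ∧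
    -- boundary data
    (∀ x ∈ frontier Om, u x = φ x))
  (Om \ (closedBall (p 0) (r 0) ∪ closedBall (p 1) (r 1)))
  (fun j => sphere (p j) (r j))

/-- The standing geometric hypotheses: `Ω` bounded open, `D1`, `D2` open balls
with disjoint closures contained in `Ω`, with positive radii. -/
def CondGeom {n : ℕ} (Om : Set (E n)) (p : Fin 2 → E n) (r : Fin 2 → ℝ) : Prop :=
  IsOpen Om ∧ Bornology.IsBounded Om ∧ (∀ j, 0 < r j) ∧
  (∀ j, closedBall (p j) (r j) ⊆ Om) ∧
  Disjoint (closedBall (p 0) (r 0)) (closedBall (p 1) (r 1))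

/-- The pure second derivatives of a `C²` function are nonpositive at a local maximum. -/
lemma iteratedFDeriv_two_nonpos_of_isLocalMax {F : Type*} [NormedAddCommGroup F] [NormedSpace ℝ F]
    {g : F → ℝ} {y : F} (hg : ContDiffAt ℝ 2 g y) (hmax : IsLocalMax g y) (v : F) :
    iteratedFDeriv ℝ 2 g y ![v, v] ≤ 0 := by
  set l : ℝ → F := fun t => y + t • v with hl
  have hl0 : l 0 = y := by simp [hl]
  have hld : ∀ t, HasDerivAt l v t := fun t => by
    simpa [hl] using ((hasDerivAt_id t).smul_const v).const_add y
  have hlc : ContinuousAt l 0 := (hld 0).continuousAt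
  have hev : ∀ᶠ x in nhds y, DifferentiableAt ℝ g x :=
    (hg.eventually (by simp)).mono fun x hx => hx.differentiableAt (by norm_num)
  have hev' : ∀ᶠ t in nhds (0 : ℝ), DifferentiableAt ℝ g (l t) :=
    hlc.eventually (by rwa [hl0])
  have hderiv : deriv (g ∘ l) =ᶠ[nhds 0] fun t => fderiv ℝ g (l t) v :=
    hev'.mono fun t ht => (ht.hasFDerivAt.comp_hasDerivAt t (hld t)).deriv
  have hfd : DifferentiableAt ℝ (fderiv ℝ g) y :=
    (hg.fderiv_right (m := 1) (by norm_num)).differentiableAt (by norm_num)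
  have h2 : HasDerivAt (fun t => fderiv ℝ g (l t) v) (fderiv ℝ (fderiv ℝ g) y v v) 0 := by
    have h := (hl0.symm ▸ hfd.hasFDerivAt :
      HasFDerivAt (fderiv ℝ g) (fderiv ℝ (fderiv ℝ g) y) (l 0)).comp_hasDerivAt 0 (hld 0)
    simpa using h.clm_apply (hasDerivAt_const (0 : ℝ) v)
  have hdd : deriv (deriv (g ∘ l)) 0 = iteratedFDeriv ℝ 2 g y ![v, v] := by
    rw [hderiv.deriv_eq, h2.deriv, iteratedFDeriv_two_apply]; simp
  have hlocmax : IsLocalMax (g ∘ l) 0 := by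
    have : ∀ᶠ t in nhds (0 : ℝ), g (l t) ≤ g y := hlc.eventually (by rw [hl0]; exact hmax)
    simpa [IsLocalMax, IsMaxFilter, hl0] using this
  by_contra! hpos
  have hcont : ContinuousAt (g ∘ l) 0 :=
    ContinuousAt.comp (by rw [hl0]; exact hg.continuousAt) hlc
  have hlocmin : IsLocalMin (g ∘ l) 0 :=
    isLocalMin_of_deriv_deriv_pos (by rwa [hdd]) hlocmax.deriv_eq_zero hcont
  have hconst : g ∘ l =ᶠ[nhds 0] fun _ => (g ∘ l) 0 := by
    filter_upwards [hlocmax, hlocmin] with t h1 h2 using le_antisymm h1 h2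
  have h0 : deriv (deriv (g ∘ l)) 0 = 0 := by
    rw [hconst.deriv.deriv_eq]; simp
  linarith

lemma elap_nonpos_of_isLocalMax {k : ℕ} {g : E k → ℝ} {y : E k} (hg : ContDiffAt ℝ 2 g y)
    (hmax : IsLocalMax g y) : elap g y ≤ 0 :=
  Finset.sum_nonpos fun _ _ => iteratedFDeriv_two_nonpos_of_isLocalMax hg hmax _

lemma elap_add {k : ℕ} {f g : E k → ℝ} {y : E k} (hf : ContDiffAt ℝ 2 f y)
    (hg : ContDiffAt ℝ 2 g y) : elap (f + g) y = elap f y + elap g y := by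
  simp only [elap, iteratedFDeriv_add_apply hf hg, ← Finset.sum_add_distrib]
  rfl

lemma elap_sub {k : ℕ} {f g : E k → ℝ} {y : E k} (hf : ContDiffAt ℝ 2 f y)
    (hg : ContDiffAt ℝ 2 g y) : elap (f - g) y = elap f y - elap g y := by
  simp only [elap, iteratedFDeriv_sub_apply hf hg, ← Finset.sum_sub_distrib]
  rfl

lemma elap_const_smul {k : ℕ} {f : E k → ℝ} {y : E k} (a : ℝ) (hf : ContDiffAt ℝ 2 f y) :
    elap (a • f) y = a * elap f y := by
  simp only [elap, iteratedFDeriv_const_smul_apply hf, Finset.mul_sum]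
  rfl

/-- The Gaussian barrier used in the proof of Hopf's lemma. -/
def gaussianBarrier {k : ℕ} (a : ℝ) (c : E k) (y : E k) : ℝ := Real.exp (-a * ‖y - c‖ ^ 2)

lemma contDiff_gaussianBarrier {k : ℕ} (a : ℝ) (c : E k) {m : WithTop ℕ∞} :
    ContDiff ℝ m (gaussianBarrier a c) :=
  Real.contDiff_exp.comp (contDiff_const.mul ((contDiff_id.sub contDiff_const).norm_sq ℝ))

lemma hasFDerivAt_gaussianBarrier {k : ℕ} (a : ℝ) (c y : E k) :
    HasFDerivAt (gaussianBarrier a c)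
      ((-2 * a * gaussianBarrier a c y) • innerSL ℝ (y - c)) y := by
  have h1 : HasFDerivAt (fun y : E k => ‖y - c‖ ^ 2) (2 • innerSL ℝ (y - c)) y := by
    simpa using ((hasFDerivAt_id y).sub_const c).norm_sq
  refine ((h1.const_mul (-a)).exp).congr_fderiv ?_
  ext v
  simp only [gaussianBarrier, smul_apply, smul_eq_mul, nsmul_eq_mul]
  push_cast
  ring

lemma elap_gaussianBarrier {k : ℕ} (a : ℝ) (c y : E k) :
    elap (gaussianBarrier a c) y =
      2 * a * gaussianBarrier a c y * (2 * a * ‖y - c‖ ^ 2 - k) := by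
  have h1 : fderiv ℝ (gaussianBarrier a c) =
      fun y => (-2 * a * gaussianBarrier a c y) • innerSL ℝ (y - c) :=
    funext fun y => (hasFDerivAt_gaussianBarrier a c y).fderiv
  obtain ⟨B, hB⟩ : ∃ B : E k →L[ℝ] E k →L[ℝ] ℝ, ∀ x, B x = innerSL ℝ x :=
    ⟨innerSL ℝ, fun _ => rfl⟩
  have h2 : HasFDerivAt (fun y : E k => innerSL ℝ (y - c)) B y := by
    simp only [← hB]
    exact B.hasFDerivAt.comp y ((hasFDerivAt_id y).sub_const c)
  have h3 := ((hasFDerivAt_gaussianBarrier a c y).const_mul (-2 * a)).fun_smul h2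
  have hterm : ∀ i : Fin k, iteratedFDeriv ℝ 2 (gaussianBarrier a c) y
      ![EuclideanSpace.single i 1, EuclideanSpace.single i 1] =
      2 * a * gaussianBarrier a c y * (2 * a * (y i - c i) ^ 2 - 1) := by
    intro i
    rw [iteratedFDeriv_two_apply, h1, h3.fderiv]
    simp [hB, EuclideanSpace.inner_single_right]
    ring
  rw [elap, Finset.sum_congr rfl fun i _ => hterm i, ← Finset.mul_sum, Finset.sum_sub_distrib,
    ← Finset.mul_sum, EuclideanSpace.norm_sq_eq]
  simp

/-- **Hopf's lemma** at the boundary point `c - R • e` of a ball of harmonicity. -/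
lemma hopf_lemma {k : ℕ} {w : E k → ℝ} {c e : E k} {R : ℝ} (hR : 0 < R) (he : ‖e‖ = 1)
    (hd : DifferentiableAt ℝ w (c - R • e))
    (hC : ∀ y ∈ closedBall c R, y ≠ c - R • e → ContDiffAt ℝ 2 w y)
    (hharm : ∀ y ∈ closedBall c R, y ≠ c - R • e → elap w y = 0)
    (hlt : ∀ y ∈ closedBall c R, y ≠ c - R • e → w y < w (c - R • e)) :
    fderiv ℝ w (c - R • e) e < 0 := by
  set x := c - R • e with hx
  have hxc : x - c = -(R • e) := by rw [hx]; abel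
  have hxn : ‖x - c‖ = R := by rw [hxc, norm_neg, norm_smul, he]; simp [hR.le]
  have hxB : x ∈ closedBall c R := by simp [dist_eq_norm, hxn]
  have hwc : ContinuousOn w (closedBall c R) := fun y hy => by
    by_cases h : y = x
    · exact h ▸ hd.continuousAt.continuousWithinAt
    · exact (hC y hy h).continuousAt.continuousWithinAt
  set a : ℝ := 2 * (k + 1) / R ^ 2 with ha
  have hapos : 0 < a := by positivity
  set h := gaussianBarrier a c with hh
  have hpos : ∀ y, 0 < h y := fun y => Real.exp_pos _
  have hhle : ∀ y, h y ≤ 1 := fun y => Real.exp_le_one_iff.2 (by nlinarith [sq_nonneg ‖y - c‖])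
  have hsph : ∀ y, ‖y - c‖ = R → h y = h x := fun y hy => by
    simp [hh, gaussianBarrier, hy, hxn]
  have hhC : ∀ y, ContDiffAt ℝ 2 h y := fun y => (contDiff_gaussianBarrier a c).contDiffAt
  have hinner : ∃ δ > 0, ∀ y ∈ closedBall c (R / 2), w y ≤ w x - δ := by
    have hsub : closedBall c (R / 2) ⊆ closedBall c R := closedBall_subset_closedBall (by linarith)
    obtain ⟨z, hz, hzmax⟩ := (isCompact_closedBall c (R / 2)).exists_isMaxOn
      ⟨c, mem_closedBall_self (by positivity)⟩ (hwc.mono hsub)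
    have hzx : z ≠ x := by
      rintro rfl
      rw [mem_closedBall, dist_eq_norm, hxn] at hz
      linarith
    refine ⟨w x - w z, sub_pos.2 (hlt z (hsub hz) hzx), fun y hy => ?_⟩
    have : w y ≤ w z := hzmax hy
    linarith
  obtain ⟨δ, hδ, hδw⟩ := hinner
  set ε := δ / 2 with hε
  have hεpos : 0 < ε := by positivity
  set g := w + ε • h with hg
  have hgv : ∀ y, g y = w y + ε * h y := fun y => rfl
  have hgC : ∀ y ∈ closedBall c R, y ≠ x → ContDiffAt ℝ 2 g y := fun y hy hyx =>
    (hC y hy hyx).add ((hhC y).const_smul ε)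
  have hcomp : IsCompact (closedBall c R \ ball c (R / 2)) :=
    (isCompact_closedBall c R).diff isOpen_ball
  have hxA : x ∈ closedBall c R \ ball c (R / 2) :=
    ⟨hxB, by rw [mem_ball, dist_eq_norm, hxn]; linarith⟩
  have hgcont : ContinuousOn g (closedBall c R) :=
    hwc.add ((contDiff_gaussianBarrier (m := 0) a c).continuous.continuousOn.const_smul ε)
  obtain ⟨z, hz, hzmax⟩ := hcomp.exists_isMaxOn ⟨x, hxA⟩ (hgcont.mono sdiff_subset)
  have hzx : g z ≤ g x := by
    by_cases hzeq : z = x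
    · rw [hzeq]
    by_contra! hcon
    have hzR : ‖z - c‖ < R := by
      refine lt_of_le_of_ne (by simpa [dist_eq_norm] using hz.1) fun heq => ?_
      rw [hgv, hgv, hsph z heq] at hcon
      linarith [hlt z hz.1 hzeq]
    have hzR2 : R / 2 < ‖z - c‖ := by
      by_contra! hle
      have := hδw z (by simpa [dist_eq_norm] using hle)
      rw [hgv, hgv] at hcon
      nlinarith [hhle z, hpos x]
    have hloc : IsLocalMax g z := by
      have hn : closedBall c R \ ball c (R / 2) ∈ nhds z := by
        have hcn : ContinuousAt (fun y => ‖y - c‖) z := by fun_prop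
        filter_upwards [hcn.eventually (gt_mem_nhds hzR), hcn.eventually (lt_mem_nhds hzR2)]
          with y h1 h2
        exact ⟨by simpa [dist_eq_norm] using h1.le, by simpa [dist_eq_norm] using h2.le⟩
      exact hzmax.isLocalMax hn
    have hle := elap_nonpos_of_isLocalMax (hgC z hz.1 hzeq) hloc
    have hsm : ContDiffAt ℝ 2 (ε • h) z := (hhC z).const_smul ε
    rw [hg, elap_add (hC z hz.1 hzeq) hsm, hharm z hz.1 hzeq,
      elap_const_smul ε (hhC z), hh, elap_gaussianBarrier, zero_add] at hle
    have hk : 0 < 2 * a * ‖z - c‖ ^ 2 - k := by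
      have h1 : (R / 2) ^ 2 < ‖z - c‖ ^ 2 := by gcongr
      have h2 : 2 * a * (R / 2) ^ 2 = k + 1 := by rw [ha]; field_simp
      nlinarith
    have := hpos z
    have : 0 < ε * (2 * a * gaussianBarrier a c z * (2 * a * ‖z - c‖ ^ 2 - k)) := by positivity
    linarith
  have hmaxx : IsMaxOn g (closedBall c R \ ball c (R / 2)) x := fun y hy =>
    (hzmax hy : g y ≤ g z).trans hzx
  have hseg : segment ℝ x (x + (R / 2) • e) ⊆ closedBall c R \ ball c (R / 2) := by
    rw [segment_eq_image']
    rintro _ ⟨t, ⟨ht0, ht1⟩, rfl⟩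
    have hnorm : ‖x + t • (x + (R / 2) • e - x) - c‖ = R - t * (R / 2) := by
      have : x + t • (x + (R / 2) • e - x) - c = (-(R - t * (R / 2))) • e := by
        rw [hx]; module
      rw [this, norm_smul, he, Real.norm_eq_abs, abs_neg, abs_of_nonneg (by nlinarith), mul_one]
    constructor
    · rw [mem_closedBall, dist_eq_norm, hnorm]; nlinarith
    · rw [mem_ball, dist_eq_norm, hnorm]; nlinarith
  have hgd : HasFDerivAt g
      (fderiv ℝ w x + ε • ((-2 * a * h x) • innerSL ℝ (x - c))) x :=
    hd.hasFDerivAt.add ((hasFDerivAt_gaussianBarrier a c x).const_smul ε)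
  have hfin := hmaxx.localize.hasFDerivWithinAt_nonpos hgd.hasFDerivWithinAt
    (mem_posTangentConeAt_of_segment_subset hseg)
  have hee : ⟪e, e⟫ = 1 := by rw [real_inner_self_eq_norm_sq, he]; norm_num
  simp only [hxc, add_apply, smul_apply, map_smul,
    innerSL_apply_apply, inner_neg_left, inner_smul_left, hee, smul_eq_mul] at hfin
  simp only [conj_trivial] at hfin
  have hp : 0 < ε * (2 * a * h x * R) := by have := hpos x; positivity
  by_contra! hcon
  nlinarith

/-- The radial projection to `sphere p r` of the coordinate hyperplane `x i = s`, centred at `p`. -/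
def hyperplaneToSphere {m : ℕ} (p : E (m + 1)) (r : ℝ) (i : Fin (m + 1)) (s : ℝ)
    (z : Fin m → ℝ) : E (m + 1) :=
  p + (r / ‖(WithLp.toLp 2 (i.insertNth s z : Fin (m + 1) → ℝ) : E (m + 1))‖) •
    WithLp.toLp 2 (i.insertNth s z : Fin (m + 1) → ℝ)

/-- A left inverse of `hyperplaneToSphere p r i s` when `|s| = 1`. -/
def sphereToHyperplane {m : ℕ} (p : E (m + 1)) (i : Fin (m + 1)) (y : E (m + 1)) : Fin m → ℝ :=
  fun j => (y (i.succAbove j) - p (i.succAbove j)) / |y i - p i|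

lemma toLp_insertNth_ne_zero {m : ℕ} (i : Fin (m + 1)) {s : ℝ} (hs : s ≠ 0) (z : Fin m → ℝ) :
    (WithLp.toLp 2 (i.insertNth s z : Fin (m + 1) → ℝ) : E (m + 1)) ≠ 0 := fun h => hs <| by
  simpa using congrArg (fun x : E (m + 1) => x i) h

lemma contDiff_hyperplaneToSphere {m : ℕ} (p : E (m + 1)) (r : ℝ) (i : Fin (m + 1)) {s : ℝ}
    (hs : s ≠ 0) : ContDiff ℝ 1 (hyperplaneToSphere p r i s) := by
  have h : ContDiff ℝ 1 fun z : Fin m → ℝ =>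
      (WithLp.toLp 2 (i.insertNth s z : Fin (m + 1) → ℝ) : E (m + 1)) := by
    rw [contDiff_euclidean]
    intro j
    rcases Fin.eq_self_or_eq_succAbove i j with rfl | ⟨k, rfl⟩
    · simpa using contDiff_const
    · simpa using contDiff_apply ℝ ℝ k
  exact contDiff_const.add ((contDiff_const.div (h.norm ℝ (toLp_insertNth_ne_zero i hs))
    fun z => norm_ne_zero_iff.2 (toLp_insertNth_ne_zero i hs z)).smul h)

lemma hyperplaneToSphere_mem {m : ℕ} (p : E (m + 1)) {r : ℝ} (hr : 0 < r) (i : Fin (m + 1)) {s : ℝ}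
    (hs : s ≠ 0) (z : Fin m → ℝ) : hyperplaneToSphere p r i s z ∈ sphere p r := by
  have := norm_pos_iff.2 (toLp_insertNth_ne_zero i hs z)
  rw [mem_sphere, dist_eq_norm, hyperplaneToSphere, add_sub_cancel_left, norm_smul,
    Real.norm_of_nonneg (by positivity)]
  field_simp

lemma sphereToHyperplane_hyperplaneToSphere {m : ℕ} (p : E (m + 1)) {r : ℝ} (hr : 0 < r)
    (i : Fin (m + 1)) {s : ℝ} (hs : |s| = 1) (z : Fin m → ℝ) :
    sphereToHyperplane p i (hyperplaneToSphere p r i s z) = z := by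
  have hs0 : s ≠ 0 := by rintro rfl; simp at hs
  have := norm_pos_iff.2 (toLp_insertNth_ne_zero i hs0 z)
  funext j
  simp only [sphereToHyperplane, hyperplaneToSphere, PiLp.add_apply, PiLp.smul_apply,
    add_sub_cancel_left, Fin.insertNth_apply_same, Fin.insertNth_apply_succAbove, smul_eq_mul,
    abs_mul, hs, mul_one]
  rw [abs_of_pos (by positivity)]
  field_simp

lemma hyperplaneToSphere_sphereToHyperplane {m : ℕ} {p y : E (m + 1)} {r : ℝ} (hr : 0 < r)
    (hy : y ∈ sphere p r) (i : Fin (m + 1)) (hi : y i - p i ≠ 0) :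
    hyperplaneToSphere p r i ((y i - p i) / |y i - p i|) (sphereToHyperplane p i y) = y := by
  have hface : (WithLp.toLp 2 (i.insertNth ((y i - p i) / |y i - p i|) (sphereToHyperplane p i y) :
      Fin (m + 1) → ℝ) : E (m + 1)) = |y i - p i|⁻¹ • (y - p) := by
    ext j
    rcases Fin.eq_self_or_eq_succAbove i j with rfl | ⟨k, rfl⟩
    · simp; field_simp
    · simp [sphereToHyperplane]; field_simp
  have hn : ‖y - p‖ = r := by simpa [dist_eq_norm] using hy
  have ha := abs_pos.2 hi
  rw [hyperplaneToSphere, hface, norm_smul, hn, norm_inv, Real.norm_eq_abs, abs_abs, smul_smul]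
  have : r / (|y i - p i|⁻¹ * r) * |y i - p i|⁻¹ = 1 := by field_simp
  rw [this, one_smul, add_sub_cancel]

lemma hausdorffMeasure_fin_pi (m : ℕ) : (μH[(m : ℝ)] : Measure (Fin m → ℝ)) = volume := by
  simpa using hausdorffMeasure_pi_real (ι := Fin m)

lemma hausdorffMeasure_sphere_lt_top {m : ℕ} (p : E (m + 1)) {r : ℝ} (hr : 0 < r) :
    μH[(m : ℝ)] (sphere p r) < ∞ := by
  have hcover : sphere p r ⊆ ⋃ i : Fin (m + 1), ⋃ b : Bool,
      hyperplaneToSphere p r i (if b then 1 else -1) '' Icc (-1) 1 := by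
    intro y hy
    obtain ⟨i, -, hi⟩ := Finset.exists_max_image Finset.univ (fun i => |y i - p i|)
      Finset.univ_nonempty
    have hi0 : y i - p i ≠ 0 := by
      intro h0
      have hyp : y = p := by
        ext j
        have := hi j (Finset.mem_univ j)
        rw [h0, abs_zero] at this
        linarith [abs_nonpos_iff.1 this]
      rw [hyp, mem_sphere, dist_self] at hy
      exact hr.ne hy
    have hle : ∀ j, |sphereToHyperplane p i y j| ≤ 1 := fun j => by
      rw [sphereToHyperplane, abs_div, abs_abs]
      exact div_le_one_of_le₀ (hi _ (Finset.mem_univ _)) (abs_nonneg _)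
    have heq := hyperplaneToSphere_sphereToHyperplane hr hy i hi0
    simp only [mem_iUnion]
    refine ⟨i, decide (0 < y i - p i), sphereToHyperplane p i y,
      ⟨fun j => (abs_le.1 (hle j)).1, fun j => (abs_le.1 (hle j)).2⟩, ?_⟩
    rcases lt_or_gt_of_ne hi0 with h | h
    · rw [abs_of_neg h, div_neg, div_self hi0] at heq
      simpa [h.not_gt] using heq
    · rw [abs_of_pos h, div_self hi0] at heq
      simpa [h] using heq
  refine (measure_mono hcover).trans_lt ?_
  refine (measure_iUnion_fintype_le _ _).trans_lt (ENNReal.sum_lt_top.2 fun i _ =>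
    (measure_iUnion_fintype_le _ _).trans_lt (ENNReal.sum_lt_top.2 fun b _ => ?_))
  obtain ⟨K, hK⟩ := (contDiff_hyperplaneToSphere p r i
    (s := if b then 1 else -1) (by split_ifs <;> norm_num)).contDiffOn.exists_lipschitzOnWith
    one_ne_zero (convex_Icc (-1 : Fin m → ℝ) 1) isCompact_Icc
  refine (hK.hausdorffMeasure_image_le (Nat.cast_nonneg m)).trans_lt ?_
  rw [hausdorffMeasure_fin_pi]
  exact ENNReal.mul_lt_top (ENNReal.rpow_lt_top_of_nonneg (Nat.cast_nonneg m) ENNReal.coe_ne_top)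
    isCompact_Icc.measure_lt_top

lemma hausdorffMeasure_inter_sphere_pos {m : ℕ} {p y : E (m + 1)} {r : ℝ} (hr : 0 < r)
    (hy : y ∈ sphere p r) {W : Set (E (m + 1))} (hW : W ∈ nhds y) :
    0 < μH[(m : ℝ)] (W ∩ sphere p r) := by
  obtain ⟨i, hi⟩ : ∃ i, y i - p i ≠ 0 := by
    by_contra! h
    have hyp : y = p := by ext j; linarith [h j]
    rw [hyp, mem_sphere, dist_self] at hy
    exact hr.ne hy
  set s := (y i - p i) / |y i - p i| with hs
  have hs1 : |s| = 1 := by rw [hs, abs_div, abs_abs, div_self (abs_ne_zero.2 hi)]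
  have hs0 : s ≠ 0 := by intro h; simp [h] at hs1
  have hC : ContDiffAt ℝ 1 (sphereToHyperplane p i) y := by
    have hc : ∀ j, ContDiffAt ℝ 1 (fun x : E (m + 1) => x j - p j) y := fun j =>
      (contDiff_euclidean.1 contDiff_id j).contDiffAt.sub contDiffAt_const
    exact contDiffAt_pi.2 fun j => (hc _).div ((hc i).abs hi) (abs_ne_zero.2 hi)
  obtain ⟨K, t, ht, hK⟩ := hC.exists_lipschitzOnWith
  set F := hyperplaneToSphere p r i s
  have hFy : F (sphereToHyperplane p i y) = y := hyperplaneToSphere_sphereToHyperplane hr hy i hi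
  have hpre : F ⁻¹' (W ∩ t) ∈ nhds (sphereToHyperplane p i y) :=
    (contDiff_hyperplaneToSphere p r i hs0).continuous.continuousAt.preimage_mem_nhds
      (by
        change W ∩ t ∈ nhds (F _)
        rw [hFy]
        exact Filter.inter_mem hW ht)
  have hsub : F ⁻¹' (W ∩ t) ⊆ sphereToHyperplane p i '' (W ∩ sphere p r ∩ t) := fun z hz =>
    ⟨F z, ⟨⟨hz.1, hyperplaneToSphere_mem p hr i hs0 z⟩, hz.2⟩,
      sphereToHyperplane_hyperplaneToSphere p hr i hs1 z⟩
  have h1 : 0 < μH[(m : ℝ)] (F ⁻¹' (W ∩ t)) := by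
    rw [hausdorffMeasure_fin_pi]
    exact Measure.measure_pos_of_mem_nhds _ hpre
  have h2 := (measure_mono hsub).trans
    ((hK.mono inter_subset_right).hausdorffMeasure_image_le (Nat.cast_nonneg m))
  have h3 : μH[(m : ℝ)] (W ∩ sphere p r ∩ t) ≠ 0 := fun h => by
    rw [h, mul_zero] at h2
    exact h1.not_ge h2
  exact (pos_iff_ne_zero.2 h3).trans_le (measure_mono inter_subset_left)

/-- Continuous functions are integrable on spheres. -/
lemma ContinuousOn.integrableOn_sphere {m : ℕ} {p : E (m + 1)} {r : ℝ} (hr : 0 < r)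
    {f : E (m + 1) → ℝ} (hf : ContinuousOn f (sphere p r)) :
    IntegrableOn f (sphere p r) μH[(m : ℝ)] := by
  have hms : MeasurableSet (sphere p r) := isClosed_sphere.measurableSet
  obtain ⟨C, hC⟩ := (isCompact_sphere p r).exists_bound_of_continuousOn hf
  exact IntegrableOn.of_bound (hausdorffMeasure_sphere_lt_top p hr)
    (hf.aestronglyMeasurable hms) C ((ae_restrict_iff' hms).2 (.of_forall hC))

/-- A nonnegative continuous function on a sphere with zero integral vanishes. -/
lemma eqOn_zero_of_setIntegral_sphere_eq_zero {m : ℕ} {p : E (m + 1)} {r : ℝ} (hr : 0 < r)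
    {f : E (m + 1) → ℝ} (hf : ContinuousOn f (sphere p r)) (hnn : ∀ y ∈ sphere p r, 0 ≤ f y)
    (hint : ∫ y in sphere p r, f y ∂μH[(m : ℝ)] = 0) : ∀ y ∈ sphere p r, f y = 0 := by
  have hms : MeasurableSet (sphere p r) := isClosed_sphere.measurableSet
  rw [setIntegral_eq_zero_iff_of_nonneg_ae ((ae_restrict_iff' hms).2 (.of_forall hnn))
    (hf.integrableOn_sphere hr), Filter.EventuallyEq, ae_restrict_iff' hms] at hint
  intro y hy
  by_contra hne
  obtain ⟨W, hW, hWsub⟩ := mem_nhdsWithin_iff_exists_mem_nhds_inter.1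
    ((hf y hy).eventually_ne hne)
  refine (hausdorffMeasure_inter_sphere_pos hr hy hW).ne' (measure_mono_null ?_ hint)
  exact fun x hx h => hWsub hx (h hx.2)

/-- The perforated domain `Ω̃`. -/
def perforated {n : ℕ} (Om : Set (E n)) (p : Fin 2 → E n) (r : Fin 2 → ℝ) : Set (E n) :=
  Om \ (closedBall (p 0) (r 0) ∪ closedBall (p 1) (r 1))

/-- The normal derivative of `u` on the sphere with center `c` and radius `s`. -/
def normalFlux {n : ℕ} (c : E n) (s : ℝ) (u : E n → ℝ) (x : E n) : ℝ :=
  ⟪s⁻¹ • (c - x), gradient u x⟫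

lemma inner_gradient_eq_fderiv {n : ℕ} (u : E n → ℝ) (x y : E n) :
    ⟪y, gradient u x⟫ = fderiv ℝ u x y := by
  rw [real_inner_comm, gradient, InnerProductSpace.toDual_symm_apply]

lemma gradient_sub_of_differentiableAt {n : ℕ} {u v : E n → ℝ} {x : E n}
    (hu : DifferentiableAt ℝ u x) (hv : DifferentiableAt ℝ v x) :
    gradient (u - v) x = gradient u x - gradient v x := by
  simp only [gradient, fderiv_sub hu hv, map_sub]

section Geometry

variable {n : ℕ} {Om : Set (E n)} {p : Fin 2 → E n} {r : Fin 2 → ℝ}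

lemma mem_perforated {x : E n} :
    x ∈ perforated Om p r ↔ x ∈ Om ∧ ∀ k, x ∉ closedBall (p k) (r k) := by
  simp only [perforated, mem_sdiff, mem_union, not_or, Fin.forall_fin_two]

lemma notMem_closedBall_of_mem_closure_perforated {x : E n}
    (hx : x ∈ closure (perforated Om p r)) {j : Fin 2} (hj : x ∉ sphere (p j) (r j)) :
    x ∉ closedBall (p j) (r j) := by
  intro hB
  obtain ⟨y, hy1, hy2⟩ := mem_closure_iff.1 hx (ball (p j) (r j)) isOpen_ball
    (lt_of_le_of_ne hB hj)
  exact (mem_perforated.1 hy2).2 j (ball_subset_closedBall hy1)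

namespace CondGeom

lemma isOpen_perforated (h : CondGeom Om p r) : IsOpen (perforated Om p r) :=
  h.1.sdiff (isClosed_closedBall.union isClosed_closedBall)

lemma isCompact_closure (h : CondGeom Om p r) : IsCompact (closure (perforated Om p r)) :=
  (h.2.1.subset sdiff_subset).isCompact_closure

lemma disjoint_closedBall (h : CondGeom Om p r) {j k : Fin 2} (hjk : j ≠ k) :
    Disjoint (closedBall (p j) (r j)) (closedBall (p k) (r k)) := by
  have h5 := h.2.2.2.2
  fin_cases j <;> fin_cases k <;> first | exact absurd rfl hjk | exact h5 | exact h5.symm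

lemma eventually_mem_perforated (h : CondGeom Om p r) {j : Fin 2} {x : E n}
    (hx : x ∈ sphere (p j) (r j)) :
    ∀ᶠ t in nhdsWithin (0 : ℝ) (Ioi 0), x + t • (x - p j) ∈ perforated Om p r := by
  have hxB : x ∈ closedBall (p j) (r j) := sphere_subset_closedBall hx
  have htend : Filter.Tendsto (fun t : ℝ => x + t • (x - p j)) (nhdsWithin 0 (Ioi 0)) (nhds x) := by
    have hc : Continuous fun t : ℝ => x + t • (x - p j) := by fun_prop
    simpa using (hc.tendsto 0).mono_left nhdsWithin_le_nhds
  have hk : ∀ k, ∀ᶠ t in nhdsWithin (0 : ℝ) (Ioi 0),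
      x + t • (x - p j) ∉ closedBall (p k) (r k) := by
    intro k
    by_cases hjk : j = k
    · subst hjk
      filter_upwards [self_mem_nhdsWithin] with t ht
      have hr := h.2.2.1 j
      have ht' : (0 : ℝ) < t := ht
      have heq : x + t • (x - p j) - p j = (1 + t) • (x - p j) := by module
      rw [mem_sphere, dist_eq_norm] at hx
      rw [mem_closedBall, dist_eq_norm, heq, norm_smul, hx, Real.norm_of_nonneg (by positivity)]
      nlinarith
    · exact htend.eventually (isClosed_closedBall.isOpen_compl.mem_nhds
        (disjoint_left.1 (h.disjoint_closedBall hjk) hxB))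
  filter_upwards [htend.eventually (h.1.mem_nhds (h.2.2.2.1 j hxB)), Filter.eventually_all.2 hk]
    with t h1 h2 using mem_perforated.2 ⟨h1, h2⟩

lemma sphere_subset_closure (h : CondGeom Om p r) (j : Fin 2) :
    sphere (p j) (r j) ⊆ closure (perforated Om p r) := by
  intro x hx
  have hc : Continuous fun t : ℝ => x + t • (x - p j) := by fun_prop
  have htend := (hc.tendsto 0).mono_left (nhdsWithin_le_nhds (s := Ioi 0))
  rw [zero_smul, add_zero] at htend
  exact mem_closure_of_tendsto htend (h.eventually_mem_perforated hx)

lemma closure_perforated_cases (h : CondGeom Om p r) {x : E n}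
    (hx : x ∈ closure (perforated Om p r)) :
    x ∈ perforated Om p r ∨ (∃ j, x ∈ sphere (p j) (r j)) ∨ x ∈ frontier Om := by
  by_cases hO : x ∈ Om
  · by_cases hB : ∃ j, x ∈ closedBall (p j) (r j)
    · obtain ⟨j, hj⟩ := hB
      exact .inr (.inl ⟨j, by_contra fun hS =>
        notMem_closedBall_of_mem_closure_perforated hx hS hj⟩)
    · exact .inl (mem_perforated.2 ⟨hO, not_exists.1 hB⟩)
  · refine .inr (.inr ?_)
    rw [h.1.frontier_eq]
    exact ⟨closure_mono sdiff_subset hx, hO⟩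

end CondGeom

end Geometry

namespace IsCondSol

section

variable {n : ℕ} {γ : ℝ} {Om : Set (E n)} {p : Fin 2 → E n} {r : Fin 2 → ℝ} {φ : E n → ℝ}
  {U : Fin 2 → ℝ} {u : E n → ℝ}

lemma continuousOn (h : IsCondSol γ Om p r φ U u) : ContinuousOn u (closure (perforated Om p r)) :=
  h.1

lemma contDiffOn (h : IsCondSol γ Om p r φ U u) : ContDiffOn ℝ 2 u (perforated Om p r) := h.2.1

lemma harmonic (h : IsCondSol γ Om p r φ U u) : ∀ x ∈ perforated Om p r, elap u x = 0 := h.2.2.1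

lemma differentiableAt_sphere (h : IsCondSol γ Om p r φ U u) (j : Fin 2) {x : E n}
    (hx : x ∈ sphere (p j) (r j)) : DifferentiableAt ℝ u x :=
  h.2.2.2.1 x (by fin_cases j; exacts [.inl (.inr hx), .inr hx])

lemma continuousOn_normalFlux (h : IsCondSol γ Om p r φ U u) (j : Fin 2) :
    ContinuousOn (normalFlux (p j) (r j) u) (sphere (p j) (r j)) := by
  have hg : ContinuousOn (fun x => gradient u x) (sphere (p j) (r j)) :=
    h.2.2.2.2.1.mono fun x hx => by fin_cases j; exacts [.inl (.inr hx), .inr hx]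
  have hc : ContinuousOn (fun x => (r j)⁻¹ • (p j - x)) (sphere (p j) (r j)) := by fun_prop
  exact hc.inner hg

lemma robin (h : IsCondSol γ Om p r φ U u) (j : Fin 2) {x : E n} (hx : x ∈ sphere (p j) (r j)) :
    u x + γ * normalFlux (p j) (r j) u x = U j := h.2.2.2.2.2.1 j x hx

lemma integral_normalFlux (h : IsCondSol γ Om p r φ U u) (j : Fin 2) :
    ∫ x in sphere (p j) (r j), normalFlux (p j) (r j) u x ∂(μH[(n : ℝ) - 1]) = 0 :=
  h.2.2.2.2.2.2.1 j

lemma eq_boundary (h : IsCondSol γ Om p r φ U u) : ∀ x ∈ frontier Om, u x = φ x :=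
  h.2.2.2.2.2.2.2

end

variable {m : ℕ} {γ : ℝ} {Om : Set (E (m + 1))} {p : Fin 2 → E (m + 1)} {r : Fin 2 → ℝ}

/-- A sign-definite normal derivative on an interface vanishes identically. -/
lemma normalFlux_eq_zero_of_nonneg {φ : E (m + 1) → ℝ} {U : Fin 2 → ℝ} {u : E (m + 1) → ℝ}
    (hgeom : CondGeom Om p r) (h : IsCondSol γ Om p r φ U u) (j : Fin 2)
    (hnn : ∀ y ∈ sphere (p j) (r j), 0 ≤ normalFlux (p j) (r j) u y) :
    ∀ y ∈ sphere (p j) (r j), normalFlux (p j) (r j) u y = 0 := by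
  have hint := h.integral_normalFlux j
  rw [Nat.cast_succ, add_sub_cancel_right] at hint
  exact eqOn_zero_of_setIntegral_sphere_eq_zero (hgeom.2.2.1 j) (h.continuousOn_normalFlux j)
    hnn hint

/-- The difference of two solutions solves the problem with zero boundary data. -/
lemma sub {φ : E (m + 1) → ℝ} {U V : Fin 2 → ℝ} {u v : E (m + 1) → ℝ} (hgeom : CondGeom Om p r)
    (hu : IsCondSol γ Om p r φ U u) (hv : IsCondSol γ Om p r φ V v) :
    IsCondSol γ Om p r 0 (U - V) (u - v) := by
  have hgrad : ∀ x ∈ perforated Om p r ∪ sphere (p 0) (r 0) ∪ sphere (p 1) (r 1),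
      gradient (u - v) x = gradient u x - gradient v x := fun x hx =>
    gradient_sub_of_differentiableAt (hu.2.2.2.1 x hx) (hv.2.2.2.1 x hx)
  have hflux : ∀ j, ∀ x ∈ sphere (p j) (r j), normalFlux (p j) (r j) (u - v) x =
      normalFlux (p j) (r j) u x - normalFlux (p j) (r j) v x := fun j x hx => by
    rw [normalFlux, gradient_sub_of_differentiableAt (hu.differentiableAt_sphere j hx)
      (hv.differentiableAt_sphere j hx), inner_sub_right]
    rfl
  have hopen := hgeom.isOpen_perforated
  refine ⟨hu.continuousOn.sub hv.continuousOn, hu.contDiffOn.sub hv.contDiffOn, fun x hx => ?_,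
    fun x hx => (hu.2.2.2.1 x hx).sub (hv.2.2.2.1 x hx),
    (hu.2.2.2.2.1.sub hv.2.2.2.2.1).congr hgrad, fun j x hx => ?_, fun j => ?_, fun x hx => ?_⟩
  · rw [elap_sub (hu.contDiffOn.contDiffAt (hopen.mem_nhds hx))
      (hv.contDiffOn.contDiffAt (hopen.mem_nhds hx)), hu.harmonic x hx, hv.harmonic x hx, sub_zero]
  · change (u - v) x + γ * normalFlux (p j) (r j) (u - v) x = (U - V) j
    rw [hflux j x hx, Pi.sub_apply, Pi.sub_apply, ← hu.robin j hx, ← hv.robin j hx]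
    ring
  · change ∫ x in sphere (p j) (r j), normalFlux (p j) (r j) (u - v) x ∂_ = 0
    rw [setIntegral_congr_fun isClosed_sphere.measurableSet (hflux j)]
    have hu0 := hu.integral_normalFlux j
    have hv0 := hv.integral_normalFlux j
    have hr := hgeom.2.2.1 j
    rw [Nat.cast_succ, add_sub_cancel_right] at hu0 hv0 ⊢
    rw [integral_sub ((hu.continuousOn_normalFlux j).integrableOn_sphere hr)
      ((hv.continuousOn_normalFlux j).integrableOn_sphere hr), hu0, hv0, sub_zero]
  · simp [hu.eq_boundary x hx, hv.eq_boundary x hx]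

/-- If a solution attains its maximum on an interface, then its normal derivative vanishes there
and it is constant on that interface. -/
lemma eq_of_isMaxOn_sphere {φ : E (m + 1) → ℝ} {W : Fin 2 → ℝ} {w : E (m + 1) → ℝ} (hγ : 0 < γ)
    (hgeom : CondGeom Om p r) (hw : IsCondSol γ Om p r φ W w) {j : Fin 2} {x : E (m + 1)}
    (hx : x ∈ sphere (p j) (r j)) (hmax : IsMaxOn w (closure (perforated Om p r)) x) :
    ∀ y ∈ sphere (p j) (r j), normalFlux (p j) (r j) w y = 0 ∧ w y = w x := by
  have hr := hgeom.2.2.1 j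
  have hcone : x - p j ∈ posTangentConeAt (closure (perforated Om p r)) x :=
    mem_posTangentConeAt_of_frequently_mem
      ((hgeom.eventually_mem_perforated hx).mono fun t ht => subset_closure ht).frequently
  have hd := hmax.localize.hasFDerivWithinAt_nonpos
    (hw.differentiableAt_sphere j hx).hasFDerivAt.hasFDerivWithinAt hcone
  have hx0 : 0 ≤ normalFlux (p j) (r j) w x := by
    rw [normalFlux, inner_gradient_eq_fderiv, map_smul, ← neg_sub, map_neg, smul_eq_mul]
    exact mul_nonneg (inv_nonneg.2 hr.le) (neg_nonneg.2 hd)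
  have hnn : ∀ y ∈ sphere (p j) (r j), 0 ≤ normalFlux (p j) (r j) w y := fun y hy => by
    have h1 := hw.robin j hx
    have h2 := hw.robin j hy
    have h3 : w y ≤ w x := hmax (hgeom.sphere_subset_closure j hy)
    exact hx0.trans (le_of_mul_le_mul_left (by linarith) hγ)
  have hzero := hw.normalFlux_eq_zero_of_nonneg hgeom j hnn
  refine fun y hy => ⟨hzero y hy, ?_⟩
  have h1 := hw.robin j hx
  have h2 := hw.robin j hy
  rw [hzero x hx] at h1
  rw [hzero y hy] at h2
  linarith

end IsCondSol

lemma eq_smul_single_of_norm_le {n : ℕ} {i : Fin n} {d : E n} {R : ℝ} (h1 : ‖d‖ ≤ R)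
    (h2 : R ≤ d i) : d = R • EuclideanSpace.single i (1 : ℝ) := by
  have hin : ⟪d, R • EuclideanSpace.single i (1 : ℝ)⟫ = R * d i := by
    simp [inner_smul_right, EuclideanSpace.inner_single_right]
  have hR : 0 ≤ R := (norm_nonneg d).trans h1
  have hsq : ‖d - R • EuclideanSpace.single i (1 : ℝ)‖ ^ 2 ≤ 0 := by
    rw [norm_sub_sq_real, hin, norm_smul, PiLp.norm_single, norm_one, mul_one,
      Real.norm_of_nonneg hR]
    nlinarith [norm_nonneg d]
  exact sub_eq_zero.1 (norm_eq_zero.1 (pow_eq_zero_iff two_ne_zero |>.1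
    (le_antisymm hsq (sq_nonneg _))))

/-- A solution with zero boundary data is nonpositive. -/
lemma IsCondSol.nonpos {m : ℕ} {γ : ℝ} {Om : Set (E (m + 1))} {p : Fin 2 → E (m + 1)}
    {r : Fin 2 → ℝ} {W : Fin 2 → ℝ} {w : E (m + 1) → ℝ} (hγ : 0 < γ)
    (hgeom : CondGeom Om p r) (hw : IsCondSol γ Om p r 0 W w) :
    ∀ x ∈ closure (perforated Om p r), w x ≤ 0 := by
  by_contra! hcon
  obtain ⟨x₀, hx₀, hpos⟩ := hcon
  set A := closure (perforated Om p r) with hA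
  have hAc : IsCompact A := hgeom.isCompact_closure
  obtain ⟨xm, hxm, hmax⟩ := hAc.exists_isMaxOn ⟨x₀, hx₀⟩ hw.continuousOn
  have hmaxle : ∀ y ∈ A, w y ≤ w xm := fun y hy => hmax hy
  have hMpos : 0 < w xm := hpos.trans_le (hmaxle _ hx₀)
  set J : Set (Fin 2) := {j | ∃ x ∈ sphere (p j) (r j), w x = w xm} with hJ
  have hflat : ∀ j ∈ J, ∀ y ∈ sphere (p j) (r j),
      normalFlux (p j) (r j) w y = 0 ∧ w y = w xm := by
    rintro j ⟨x, hx, hxe⟩ y hy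
    rw [← hxe]
    exact hw.eq_of_isMaxOn_sphere hγ hgeom hx (fun z hz => (hmaxle z hz).trans_eq hxe.symm) y hy
  set K : Set (E (m + 1)) := (A ∩ w ⁻¹' {w xm}) ∪ ⋃ j ∈ J, closedBall (p j) (r j) with hK
  have hKc : IsCompact K :=
    (hAc.of_isClosed_subset (hw.continuousOn.preimage_isClosed_of_isClosed isClosed_closure
      isClosed_singleton) inter_subset_left).union
      (J.toFinite.isCompact_biUnion fun j _ => isCompact_closedBall _ _)
  obtain ⟨x, hxK, hxmax⟩ := hKc.exists_isMaxOn ⟨xm, .inl ⟨hxm, rfl⟩⟩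
    (f := fun y : E (m + 1) => y 0) (by fun_prop)
  have hxmax' : ∀ y ∈ K, y 0 ≤ x 0 := fun y hy => hxmax hy
  set e : E (m + 1) := EuclideanSpace.single 0 1 with he
  have hen : ‖e‖ = 1 := by simp [he]
  have hball : ∀ j ∈ J, x ∈ closedBall (p j) (r j) → x - p j = r j • e := by
    intro j hj hxj
    have hr := hgeom.2.2.1 j
    refine eq_smul_single_of_norm_le (by simpa [dist_eq_norm] using hxj) ?_
    have hq : p j + r j • e ∈ K := .inr <| mem_biUnion hj <| by
      rw [mem_closedBall, dist_eq_norm, add_sub_cancel_left, norm_smul, hen, mul_one,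
        Real.norm_of_nonneg hr.le]
    have := hxmax' _ hq
    simp [he] at this
    simp
    linarith
  have hballS : ∀ j ∈ J, x ∈ closedBall (p j) (r j) → x ∈ sphere (p j) (r j) := by
    intro j hj hxj
    rw [mem_sphere, dist_eq_norm, hball j hj hxj, norm_smul, hen, mul_one,
      Real.norm_of_nonneg (hgeom.2.2.1 j).le]
  have hxA : x ∈ A ∧ w x = w xm := by
    rcases hxK with h | h
    · exact h
    · obtain ⟨j, hj, hxj⟩ := mem_iUnion₂.1 h
      have hS := hballS j hj hxj
      exact ⟨hgeom.sphere_subset_closure j hS, (hflat j hj x hS).2⟩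
  have hxO : x ∈ Om ∧ DifferentiableAt ℝ w x ∧ fderiv ℝ w x e = 0 := by
    rcases hgeom.closure_perforated_cases hxA.1 with h | ⟨j, h⟩ | h
    · have hn := hgeom.isOpen_perforated.mem_nhds h
      refine ⟨h.1, (hw.contDiffOn.contDiffAt hn).differentiableAt (by norm_num), ?_⟩
      have hloc : IsLocalMax w x := by
        filter_upwards [hn] with y hy
        exact (hmaxle y (subset_closure hy)).trans_eq hxA.2.symm
      simp [hloc.fderiv_eq_zero]
    · have hj : j ∈ J := ⟨x, h, hxA.2⟩
      have hr := hgeom.2.2.1 j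
      have hB := sphere_subset_closedBall h
      refine ⟨hgeom.2.2.2.1 j hB, hw.differentiableAt_sphere j h, ?_⟩
      have hf := (hflat j hj x h).1
      rw [normalFlux, inner_gradient_eq_fderiv, ← neg_sub, hball j hj hB, map_smul, map_neg,
        map_smul, smul_eq_mul, smul_eq_mul] at hf
      field_simp at hf
      linarith
    · have h0 : w x = 0 := hw.eq_boundary x h
      linarith [hxA.2]
  obtain ⟨hxOm, hxd, hxe⟩ := hxO
  have hev : ∀ᶠ y in nhds x, x 0 < y 0 → y ∈ perforated Om p r := by
    have hk : ∀ k, ∀ᶠ y in nhds x, x 0 < y 0 → y ∉ closedBall (p k) (r k) := by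
      intro k
      by_cases hkJ : k ∈ J
      · exact .of_forall fun y hy hyk => (hxmax' y (.inr (mem_biUnion hkJ hyk))).not_gt hy
      · have hxk : x ∉ closedBall (p k) (r k) :=
          notMem_closedBall_of_mem_closure_perforated hxA.1 fun hS => hkJ ⟨x, hS, hxA.2⟩
        exact (isClosed_closedBall.isOpen_compl.eventually_mem hxk).mono fun y hy _ => hy
    filter_upwards [hgeom.1.mem_nhds hxOm, Filter.eventually_all.2 hk] with y h1 h2 h3
    exact mem_perforated.2 ⟨h1, fun k => h2 k h3⟩
  obtain ⟨ρ, hρ, hρball⟩ := Metric.eventually_nhds_iff.1 hev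
  set R := ρ / 3 with hR
  have hRpos : 0 < R := by positivity
  set c := x + R • e with hc
  have hxc : c - R • e = x := by rw [hc]; abel
  have hin : ∀ y ∈ closedBall c R, y ≠ x → x 0 < y 0 ∧ y ∈ perforated Om p r := by
    intro y hy hyx
    rw [mem_closedBall, dist_eq_norm] at hy
    have hlt : x 0 < y 0 := by
      by_contra! hle
      refine hyx ?_
      have hcy : c - y = R • e := by
        refine eq_smul_single_of_norm_le (by rwa [norm_sub_rev]) ?_
        simp [hc, he]
        linarith
      rw [← hxc, ← hcy]
      abel
    refine ⟨hlt, hρball ?_ hlt⟩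
    have : y - x = (y - c) + R • e := by rw [hc]; abel
    rw [dist_eq_norm, this]
    refine (norm_add_le _ _).trans_lt ?_
    rw [norm_smul, hen, Real.norm_of_nonneg hRpos.le]
    linarith
  have hhopf := hopf_lemma (w := w) (c := c) (e := e) hRpos hen (by rwa [hxc])
    (fun y hy hyx => hw.contDiffOn.contDiffAt
      (hgeom.isOpen_perforated.mem_nhds (hin y hy (by rwa [hxc] at hyx)).2))
    (fun y hy hyx => hw.harmonic y (hin y hy (by rwa [hxc] at hyx)).2)
    (fun y hy hyx => by
      rw [hxc] at hyx ⊢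
      obtain ⟨h1, h2⟩ := hin y hy hyx
      rw [hxA.2]
      refine lt_of_le_of_ne (hmaxle y (subset_closure h2)) fun heq => ?_
      exact (hxmax' y (.inl ⟨subset_closure h2, heq⟩)).not_gt h1)
  rw [hxc, hxe] at hhopf
  exact lt_irrefl _ hhopf

/-- Lemma 2.2 (uniqueness of solutions to the imperfect-bonding problem). -/
theorem uniqueness_of_solutions (n : ℕ) (hn : 2 ≤ n) (γ : ℝ) (hγ : 0 < γ)
    (Om : Set (E n)) (p : Fin 2 → E n) (r : Fin 2 → ℝ) (hgeom : CondGeom Om p r)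
    (φ : E n → ℝ) (hφ : ContinuousOn φ (frontier Om))
    (U V : Fin 2 → ℝ) (u v : E n → ℝ)
    (hu : IsCondSol γ Om p r φ U u) (hv : IsCondSol γ Om p r φ V v) :
    Set.EqOn u v (closure (Om \ (closedBall (p 0) (r 0) ∪ closedBall (p 1) (r 1)))) ∧
    (∀ j : Fin 2, U j = V j) := by
  obtain ⟨m, rfl⟩ : ∃ m, n = m + 1 := ⟨n - 1, by omega⟩
  have huv := hu.sub hgeom hv
  have hvu := hv.sub hgeom hu
  have heq : Set.EqOn u v (closure (perforated Om p r)) := fun x hx =>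
    le_antisymm (sub_nonpos.1 (huv.nonpos hγ hgeom x hx)) (sub_nonpos.1 (hvu.nonpos hγ hgeom x hx))
  have hle : ∀ {U V : Fin 2 → ℝ} {u v : E (m + 1) → ℝ}, IsCondSol γ Om p r 0 (U - V) (u - v) →
      Set.EqOn u v (closure (perforated Om p r)) → ∀ j, U j ≤ V j := by
    intro U V u v h heq j
    by_contra! hlt
    have hflux : ∀ y ∈ sphere (p j) (r j), 0 < normalFlux (p j) (r j) (u - v) y := by
      intro y hy
      have hrob := h.robin j hy
      rw [Pi.sub_apply, Pi.sub_apply, heq (hgeom.sphere_subset_closure j hy), sub_self,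
        zero_add] at hrob
      exact pos_of_mul_pos_right (hrob ▸ sub_pos.2 hlt) hγ.le
    obtain ⟨y, hy⟩ : (sphere (p j) (r j)).Nonempty :=
      NormedSpace.sphere_nonempty.2 (hgeom.2.2.1 j).le
    exact (hflux y hy).ne' (h.normalFlux_eq_zero_of_nonneg hgeom j (fun z hz => (hflux z hz).le) y hy)
  exact ⟨heq, fun j => le_antisymm (hle huv heq j) (hle hvu heq.symm j)⟩
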